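/- Assume that u ↦ Ef(x,u) is closed for every x ∈ 𝓝, that φ is proper, that ∂φ(u) ≠ ∅, and that for every y ∈ ∂φ(u) there exists v ∈ 𝓝^⊥ with φ*(y) = Ef*(v,y). Then x ∈ 𝓝 solves (P_u) if and only if x is feasible and there exist y ∈ 𝓨 and v ∈ 𝓝^⊥ such that v(ω) ∈ ∂ₓl(x(ω),y(ω),ω) and u(ω) ∈ ∂_y[−l](x(ω),y(ω),ω) for P-almost every ω. -/

import Mathlib

open MeasureTheory
open scoped ENNReal

noncomputable section

/-- The positive part of an extended real number, as an extended nonnegative real. -/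
def epos (a : EReal) : ℝ≥0∞ := if a = ⊤ then ⊤ else ENNReal.ofReal a.toReal

/-- Expectation of an extended-real-valued function: it equals `+∞` unless the positive
part is integrable, in which case it is the usual (possibly `-∞`) integral. -/
def EE {Ω : Type} [MeasurableSpace Ω] (P : Measure Ω) (φ : Ω → EReal) : EReal :=
  if ∫⁻ ω, epos (φ ω) ∂P = ⊤ then ⊤
  else ((∫⁻ ω, epos (φ ω) ∂P : ℝ≥0∞) : EReal) - ((∫⁻ ω, epos (-(φ ω)) ∂P : ℝ≥0∞) : EReal)

/-- `ℝ^n` viewed as `ℝ^{n_0} × ⋯ × ℝ^{n_T}`. -/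
abbrev Vec {T : ℕ} (nt : Fin (T+1) → ℕ) : Type := (t : Fin (T+1)) → Fin (nt t) → ℝ

/-- `x·v = Σ_t x_t·v_t`. -/
def dotN {T : ℕ} (nt : Fin (T+1) → ℕ) (a b : Vec nt) : ℝ := ∑ t, ∑ i, a t i * b t i

/-- The scalar product on `ℝ^m`. -/
def dotM {m : ℕ} (a b : Fin m → ℝ) : ℝ := ∑ j, a j * b j

variable {Ω : Type} [MeasurableSpace Ω] {T : ℕ} {nt : Fin (T+1) → ℕ} {m : ℕ}

/-- The space `𝓝` of adapted strategies. -/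
def Nspace (nt : Fin (T+1) → ℕ) (ℱ : Fin (T+1) → MeasurableSpace Ω) :
    Set (Ω → Vec nt) := {x | ∀ t, Measurable[ℱ t] (fun ω => x ω t)}

/-- The space `𝓝^∞` of essentially bounded adapted strategies. -/
def NspaceInf (nt : Fin (T+1) → ℕ) (ℱ : Fin (T+1) → MeasurableSpace Ω)
    (P : Measure Ω) : Set (Ω → Vec nt) :=
  {x | x ∈ Nspace nt ℱ ∧ ∃ M : ℝ, ∀ᵐ ω ∂P, ‖x ω‖ ≤ M}

/-- The annihilator `𝓝^⊥` of `𝓝^∞` in `L¹`. -/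
def Nperp (nt : Fin (T+1) → ℕ) (ℱ : Fin (T+1) → MeasurableSpace Ω)
    (P : Measure Ω) : Set (Ω → Vec nt) :=
  {v | Measurable v ∧ Integrable v P ∧
    ∀ x ∈ NspaceInf nt ℱ P, ∫ ω, dotN nt (x ω) (v ω) ∂P = 0}

/-- `Ef(x,u)`. -/
def intF (P : Measure Ω) (f : Vec nt → (Fin m → ℝ) → Ω → EReal)
    (x : Ω → Vec nt) (u : Ω → Fin m → ℝ) : EReal :=
  EE P (fun ω => f (x ω) (u ω) ω)

/-- The bilinear pairing `⟨u,y⟩ = E(u·y)`. -/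
def pairing (P : Measure Ω) (u y : Ω → Fin m → ℝ) : ℝ := ∫ ω, dotM (u ω) (y ω) ∂P

/-- The value function `φ(u) = inf_{x∈𝓝} Ef(x,u)`. -/
def valueFn (P : Measure Ω) (f : Vec nt → (Fin m → ℝ) → Ω → EReal)
    (ℱ : Fin (T+1) → MeasurableSpace Ω) (u : Ω → Fin m → ℝ) : EReal :=
  ⨅ x ∈ Nspace nt ℱ, intF P f x u

/-- The auxiliary value function `φ̃(u) = inf_{x∈𝓝^∞} Ef(x,u)`. -/
def valueFnInf (P : Measure Ω) (f : Vec nt → (Fin m → ℝ) → Ω → EReal)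
    (ℱ : Fin (T+1) → MeasurableSpace Ω) (u : Ω → Fin m → ℝ) : EReal :=
  ⨅ x ∈ NspaceInf nt ℱ P, intF P f x u

/-- The conjugate on `𝓨` of a function `g` on `𝓤`. -/
def conj (P : Measure Ω) (𝓤 : Set (Ω → Fin m → ℝ)) (g : (Ω → Fin m → ℝ) → EReal)
    (y : Ω → Fin m → ℝ) : EReal :=
  ⨆ u ∈ 𝓤, (((pairing P u y : ℝ) : EReal) - g u)

/-- The Lagrangian integrand `l(x,y,ω) = inf_u {f(x,u,ω) − u·y}`. -/
def lagr (f : Vec nt → (Fin m → ℝ) → Ω → EReal) (x : Vec nt) (y : Fin m → ℝ)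
    (ω : Ω) : EReal :=
  ⨅ u : Fin m → ℝ, (f x u ω - ((dotM u y : ℝ) : EReal))

/-- `El(x,y)`. -/
def intL (P : Measure Ω) (f : Vec nt → (Fin m → ℝ) → Ω → EReal)
    (x : Ω → Vec nt) (y : Ω → Fin m → ℝ) : EReal :=
  EE P (fun ω => lagr f (x ω) (y ω) ω)

/-- The pointwise conjugate `f*(v,y,ω)`. -/
def fconj (f : Vec nt → (Fin m → ℝ) → Ω → EReal) (v : Vec nt) (y : Fin m → ℝ)
    (ω : Ω) : EReal :=
  ⨆ x : Vec nt, ⨆ u : Fin m → ℝ, (((dotN nt x v + dotM u y : ℝ) : EReal) - f x u ω)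

/-- `Ef*(v,y)`. -/
def intFconj (P : Measure Ω) (f : Vec nt → (Fin m → ℝ) → Ω → EReal)
    (v : Ω → Vec nt) (y : Ω → Fin m → ℝ) : EReal :=
  EE P (fun ω => fconj f (v ω) (y ω) ω)

/-- `l̲(x,y,ω) = sup_v {x·v − f*(v,y,ω)}`. -/
def lagrLow (f : Vec nt → (Fin m → ℝ) → Ω → EReal) (x : Vec nt) (y : Fin m → ℝ)
    (ω : Ω) : EReal :=
  ⨆ v : Vec nt, (((dotN nt x v : ℝ) : EReal) - fconj f v y ω)

/-- `El̲(x,y)`. -/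
def intLlow (P : Measure Ω) (f : Vec nt → (Fin m → ℝ) → Ω → EReal)
    (x : Ω → Vec nt) (y : Ω → Fin m → ℝ) : EReal :=
  EE P (fun ω => lagrLow f (x ω) (y ω) ω)

/-- `dom₁ Ef = {x ∈ 𝓝 : Ef(x,u) < +∞ for some u ∈ 𝓤}`. -/
def dom1intF (P : Measure Ω) (f : Vec nt → (Fin m → ℝ) → Ω → EReal)
    (ℱ : Fin (T+1) → MeasurableSpace Ω) (𝓤 : Set (Ω → Fin m → ℝ)) :
    Set (Ω → Vec nt) :=
  {x | x ∈ Nspace nt ℱ ∧ ∃ u ∈ 𝓤, intF P f x u < ⊤}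

/-- The algebraic closure of a convex set in a real vector space. -/
def acl {A : Type} [AddCommGroup A] [Module ℝ A] (C : Set A) : Set A :=
  {x | ∃ z ∈ C, ∀ lam : ℝ, 0 < lam → lam ≤ 1 → ((1 - lam) • x + lam • z) ∈ C}

/-- Decomposability of a set of measurable functions. -/
def Decomposable (P : Measure Ω) (𝓤 : Set (Ω → Fin m → ℝ)) : Prop :=
  ∀ A : Set Ω, MeasurableSet A → ∀ u ∈ 𝓤, ∀ u' : Ω → Fin m → ℝ,
    Measurable u' → (∃ M : ℝ, ∀ᵐ ω ∂P, ‖u' ω‖ ≤ M) →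
    (fun ω => A.indicator u ω + Aᶜ.indicator u' ω) ∈ 𝓤

end

/-- The weak topology `σ(𝓤,𝓨)` on `𝓤`. -/
noncomputable def weakTop {Ω : Type} [MeasurableSpace Ω] {m : ℕ} (P : Measure Ω)
    (𝓤 𝓨 : Set (Ω → Fin m → ℝ)) : TopologicalSpace {u // u ∈ 𝓤} :=
  TopologicalSpace.induced
    (fun u : {u // u ∈ 𝓤} => fun y : {y // y ∈ 𝓨} => pairing P u.1 y.1) Pi.topologicalSpace

/-- A function on `𝓤` is closed if it is `σ(𝓤,𝓨)`-lower semicontinuous and either proper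
or constant. -/
def ClosedFn {Ω : Type} [MeasurableSpace Ω] {m : ℕ} (P : Measure Ω)
    (𝓤 𝓨 : Set (Ω → Fin m → ℝ)) (g : (Ω → Fin m → ℝ) → EReal) : Prop :=
  (@LowerSemicontinuous _ _ (weakTop P 𝓤 𝓨) _ (fun u : {u // u ∈ 𝓤} => g u.1)) ∧
  (((∀ u ∈ 𝓤, g u ≠ ⊥) ∧ ∃ u ∈ 𝓤, g u ≠ ⊤) ∨ ∃ c : EReal, ∀ u ∈ 𝓤, g u = c)

/-- The subdifferential `∂g(u) ⊆ 𝓨` of a function `g` on `𝓤`. -/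
def subdiffFn {Ω : Type} [MeasurableSpace Ω] {m : ℕ} (P : Measure Ω)
    (𝓤 𝓨 : Set (Ω → Fin m → ℝ)) (g : (Ω → Fin m → ℝ) → EReal)
    (u : Ω → Fin m → ℝ) : Set (Ω → Fin m → ℝ) :=
  {y | y ∈ 𝓨 ∧ ∀ u' ∈ 𝓤, g u + ((pairing P (u' - u) y : ℝ) : EReal) ≤ g u'}

section Aux
open Set Filter Topology

theorem aux_compact {α : Type*} [TopologicalSpace α] [MeasurableSpace α]
    (μ : Measure α) [μ.OuterRegular]
    (f : (ℕ → ℕ) → α) (hf : Continuous f) (a : ℝ≥0∞) (ha : a < μ (range f)) :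
    ∃ K : Set (ℕ → ℕ), IsCompact K ∧ a ≤ μ (f '' K) := by
  have step : ∀ (k : ℕ) (S : {S : Set (ℕ → ℕ) // a < μ (f '' S)}),
      ∃ j : ℕ, a < μ (f '' (S.1 ∩ {σ | σ k ≤ j})) := by
    intro k S
    have h1 : f '' S.1 = ⋃ j : ℕ, f '' (S.1 ∩ {σ | σ k ≤ j}) := by
      rw [← image_iUnion, ← inter_iUnion]
      congr 1
      have : (⋃ j : ℕ, {σ : ℕ → ℕ | σ k ≤ j}) = univ :=
        eq_univ_of_forall fun σ => mem_iUnion.2 ⟨σ k, le_refl (σ k)⟩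
      rw [this, inter_univ]
    have hm : Monotone fun j : ℕ => f '' (S.1 ∩ {σ | σ k ≤ j}) := by
      intro i j hij
      apply image_mono
      apply inter_subset_inter_right
      intro σ hσ
      exact le_trans hσ hij
    have h2 := S.2
    rw [h1, hm.measure_iUnion] at h2
    exact lt_iSup_iff.1 h2
  choose j hj using step
  let R : ℕ → {S : Set (ℕ → ℕ) // a < μ (f '' S)} := fun k => Nat.rec
    ⟨univ, by rwa [image_univ]⟩ (fun k S => ⟨S.1 ∩ {σ | σ k ≤ j k S}, hj k S⟩) k
  let n : ℕ → ℕ := fun k => j k (R k)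
  have hR : ∀ k, (R k).1 = {σ | ∀ i < k, σ i ≤ n i} := by
    intro k
    induction k with
    | zero => simp [R]
    | succ k ih =>
      have : (R (k+1)).1 = (R k).1 ∩ {σ | σ k ≤ n k} := rfl
      rw [this, ih]
      ext σ
      simp only [mem_inter_iff, mem_ofPred_eq, Nat.lt_succ_iff_lt_or_eq]
      constructor
      · rintro ⟨h1, h2⟩ i (hi | rfl)
        · exact h1 i hi
        · exact h2
      · intro h
        exact ⟨fun i hi => h i (Or.inl hi), h k (Or.inr rfl)⟩
  have hK : IsCompact (Set.pi univ fun i => Iic (n i)) :=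
    isCompact_univ_pi fun i => (finite_Iic (n i)).isCompact
  refine ⟨_, hK, ?_⟩
  by_contra hlt
  rw [not_le] at hlt
  obtain ⟨U, hU, hUo, hUa⟩ := exists_isOpen_lt_of_lt _ _ hlt
  have : ∃ k, (R k).1 ⊆ f ⁻¹' U := by
    by_contra hno
    push Not at hno
    have : ∀ k, ∃ σ, σ ∈ (R k).1 ∧ f σ ∉ U := by
      intro k
      obtain ⟨σ, h1, h2⟩ := not_subset.1 (hno k)
      exact ⟨σ, h1, h2⟩
    choose σ hσ1 hσ2 using this
    obtain ⟨τ, hτ, φ, hφ, hlim⟩ := hK.tendsto_subseq (x := fun k i => min (σ k i) (n i))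
      (fun k i _ => mem_Iic.2 (min_le_right _ _))
    have hlim2 : Tendsto (fun k => σ (φ k)) atTop (𝓝 τ) := by
      rw [tendsto_pi_nhds] at hlim ⊢
      intro i
      refine (hlim i).congr' ?_
      filter_upwards [eventually_gt_atTop i] with k hk
      have := hσ1 (φ k)
      rw [hR] at this
      exact min_eq_left (this i (lt_of_lt_of_le hk (hφ.id_le k)))
    have hc : IsClosed (f ⁻¹' U)ᶜ := (hUo.preimage hf).isClosed_compl
    have := hc.mem_of_tendsto hlim2 (Eventually.of_forall fun k => hσ2 (φ k))
    exact this (hU (mem_image_of_mem f hτ))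
  obtain ⟨k, hk⟩ := this
  have h3 : μ (f '' (R k).1) ≤ μ U := measure_mono (image_subset_iff.2 hk)
  exact absurd ((R k).2.trans_le h3) (not_lt.2 hUa.le)

theorem aux_analytic {α : Type*} [TopologicalSpace α] [T2Space α] [MeasurableSpace α] [BorelSpace α]
    (μ : Measure α) [μ.OuterRegular] [IsFiniteMeasure μ] {A : Set α} (hA : AnalyticSet A) :
    NullMeasurableSet A μ := by
  rw [AnalyticSet] at hA
  rcases hA with rfl | ⟨f, hf, rfl⟩
  · exact MeasurableSet.empty.nullMeasurableSet
  by_cases h0 : μ (range f) = 0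
  · exact NullMeasurableSet.of_null h0
  have : ∀ n : ℕ, ∃ K : Set (ℕ → ℕ), IsCompact K ∧ μ (range f) - ((n : ℝ≥0∞)+1)⁻¹ ≤ μ (f '' K) :=
    fun n => aux_compact μ f hf _ (ENNReal.sub_lt_self (measure_ne_top _ _) h0 (by simp))
  choose K hK hμ using this
  have hB : MeasurableSet (⋃ n, f '' K n) :=
    MeasurableSet.iUnion fun n => ((hK n).image hf).isClosed.measurableSet
  have hsub : (⋃ n, f '' K n) ⊆ range f := iUnion_subset fun n => image_subset_range _ _
  have hle : μ (range f) ≤ μ (⋃ n, f '' K n) := by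
    have ht : Tendsto (fun n : ℕ => μ (range f) - ((n : ℝ≥0∞)+1)⁻¹) atTop (𝓝 (μ (range f) - 0)) := by
      apply ENNReal.Tendsto.sub tendsto_const_nhds _ (Or.inl (measure_ne_top _ _))
      have := (tendsto_add_atTop_iff_nat 1).2 ENNReal.tendsto_inv_nat_nhds_zero
      simpa using this
    rw [tsub_zero] at ht
    exact le_of_tendsto' ht fun n => (hμ n).trans (measure_mono (subset_iUnion (fun n => f '' K n) n))
  exact hB.nullMeasurableSet.congr
    (ae_eq_of_subset_of_measure_ge hsub hle hB.nullMeasurableSet (measure_ne_top _ _))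

theorem aux_factor {Z Ω : Type*} [MeasurableSpace Z] [MeasurableSpace Ω] (S : Set (Z × Ω))
    (hS : MeasurableSet S) : ∃ g : Ω → (ℕ → Bool), Measurable g ∧ ∃ S' : Set (Z × (ℕ → Bool)),
      MeasurableSet S' ∧ S = (Prod.map id g) ⁻¹' S' := by
  classical
  induction S, hS using MeasurableSpace.induction_on_inter generateFrom_prod.symm isPiSystem_prod with
  | empty => exact ⟨fun _ _ => true, measurable_const, ∅, MeasurableSet.empty, rfl⟩
  | basic t ht =>
    obtain ⟨A, hA, B, hB, rfl⟩ := ht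
    refine ⟨fun ω _ => decide (ω ∈ B), ?_, A ×ˢ {s | s 0 = true}, ?_, ?_⟩
    · refine measurable_pi_lambda _ fun _ => ?_
      refine measurable_to_bool ?_
      have : (fun ω => decide (ω ∈ B)) ⁻¹' {true} = B := by ext; simp
      rw [this]; exact hB
    · refine MeasurableSet.prod hA ?_
      exact measurableSet_eq_fun (measurable_pi_apply 0) measurable_const
    · ext ⟨z, ω⟩; simp
  | compl t ht ih =>
    obtain ⟨g, hg, S', hS', rfl⟩ := ih
    exact ⟨g, hg, S'ᶜ, hS'.compl, rfl⟩
  | iUnion s hd hs ih =>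
    choose g hg S' hS' heq using ih
    refine ⟨fun ω k => g (Nat.unpair k).1 ω (Nat.unpair k).2, ?_,
      ⋃ i, (Prod.map id (fun (s : ℕ → Bool) (k : ℕ) => s (Nat.pair i k))) ⁻¹' S' i, ?_, ?_⟩
    · exact measurable_pi_lambda _ fun k => (measurable_pi_apply _).comp (hg _)
    · refine MeasurableSet.iUnion fun i => ?_
      refine (measurable_id.prodMap ?_) (hS' i)
      exact measurable_pi_lambda _ fun k => measurable_pi_apply _
    · rw [preimage_iUnion]
      refine iUnion_congr fun i => ?_
      rw [heq i, ← preimage_comp]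
      congr 1
      ext ⟨z, ω⟩ <;> simp

theorem aux_proj {Z Ω : Type*} [TopologicalSpace Z] [PolishSpace Z] [MeasurableSpace Z] [BorelSpace Z]
    [MeasurableSpace Ω] (P : Measure Ω) [IsFiniteMeasure P] (S : Set (Z × Ω))
    (hS : MeasurableSet S) : NullMeasurableSet {ω | ∃ z, (z, ω) ∈ S} P := by
  obtain ⟨g, hg, S', hS', rfl⟩ := aux_factor S hS
  have : PolishSpace Bool := inferInstance
  have : PolishSpace (ℕ → Bool) := inferInstance
  have : PolishSpace (Z × (ℕ → Bool)) := inferInstance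
  have h1 : AnalyticSet (Prod.snd '' S') := hS'.analyticSet.image_of_continuous continuous_snd
  have h2 := aux_analytic (P.map g) h1
  have h3 := h2.preimage (hg.measurePreserving P).quasiMeasurePreserving
  convert h3 using 1
  ext ω
  simp

theorem aux_sup {Z Ω : Type*} [TopologicalSpace Z] [PolishSpace Z] [MeasurableSpace Z] [BorelSpace Z]
    [MeasurableSpace Ω] (P : Measure Ω) [IsFiniteMeasure P] (h : Z × Ω → EReal)
    (hh : Measurable h) : AEMeasurable (fun ω => ⨆ z, h (z, ω)) P := by
  apply NullMeasurable.aemeasurable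
  refine @measurable_of_Ioi EReal (NullMeasurableSpace Ω P) _ _ _ _ _ _ _ _ fun a => ?_
  have := aux_proj P (h ⁻¹' Ioi a) (hh measurableSet_Ioi)
  have he : (fun ω => ⨆ z, h (z, ω)) ⁻¹' Ioi a = {ω | ∃ z, (z, ω) ∈ h ⁻¹' Ioi a} := by
    ext ω
    simp [lt_iSup_iff]
  have h2 : NullMeasurableSet ((fun ω => ⨆ z, h (z, ω)) ⁻¹' Ioi a) P := by
    rw [he]; exact this
  exact h2
theorem aux_EE {Ω : Type} [MeasurableSpace Ω] (P : Measure Ω) (F : Ω → EReal)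
    (hF : AEMeasurable F P) (htop : EE P F ≠ ⊤) (hbot : EE P F ≠ ⊥) :
    (∀ᵐ ω ∂P, F ω = (((F ω).toReal : ℝ) : EReal)) ∧ Integrable (fun ω => (F ω).toReal) P ∧
      EE P F = ((∫ ω, (F ω).toReal ∂P : ℝ) : EReal) := by
  have e1 : AEMeasurable (fun ω => epos (F ω)) P := measurable_ereal_toENNReal.comp_aemeasurable hF
  have e2 : AEMeasurable (fun ω => epos (-(F ω))) P :=
    measurable_ereal_toENNReal.comp_aemeasurable (measurable_neg.comp_aemeasurable hF)
  have h1 : ∫⁻ ω, epos (F ω) ∂P ≠ ⊤ := by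
    intro h
    exact htop (by rw [EE, if_pos h])
  have hEE : EE P F = ((∫⁻ ω, epos (F ω) ∂P : ℝ≥0∞) : EReal)
      - ((∫⁻ ω, epos (-(F ω)) ∂P : ℝ≥0∞) : EReal) := by
    rw [EE, if_neg h1]
  have h2 : ∫⁻ ω, epos (-(F ω)) ∂P ≠ ⊤ := by
    intro h
    apply hbot
    rw [hEE, h]
    simp
  have a1 : ∀ᵐ ω ∂P, F ω ≠ ⊤ := by
    filter_upwards [ae_lt_top' e1 h1] with ω hω h
    rw [h, epos, if_pos rfl] at hω
    exact lt_irrefl _ hω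
  have a2 : ∀ᵐ ω ∂P, F ω ≠ ⊥ := by
    filter_upwards [ae_lt_top' e2 h2] with ω hω h
    rw [h, epos, if_pos EReal.neg_bot] at hω
    exact lt_irrefl _ hω
  have a3 : ∀ᵐ ω ∂P, F ω = (((F ω).toReal : ℝ) : EReal) := by
    filter_upwards [a1, a2] with ω h1 h2
    exact (EReal.coe_toReal h1 h2).symm
  have b1 : ∫⁻ ω, epos (F ω) ∂P = ∫⁻ ω, ENNReal.ofReal (F ω).toReal ∂P := by
    apply lintegral_congr_ae
    filter_upwards [a1] with ω h1
    rw [epos, if_neg h1]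
  have b2 : ∫⁻ ω, epos (-(F ω)) ∂P = ∫⁻ ω, ENNReal.ofReal (-(F ω).toReal) ∂P := by
    apply lintegral_congr_ae
    filter_upwards [a2] with ω h2
    rw [epos, if_neg (fun h => h2 (EReal.neg_eq_top_iff.1 h)), EReal.toReal_neg_eq]
  have hm : AEMeasurable (fun ω => (F ω).toReal) P := measurable_ereal_toReal.comp_aemeasurable hF
  have hint : Integrable (fun ω => (F ω).toReal) P := by
    refine ⟨hm.aestronglyMeasurable, ?_⟩
    have : ∀ r : ℝ, ‖r‖ₑ = ENNReal.ofReal r + ENNReal.ofReal (-r) := by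
      intro r
      rw [Real.enorm_eq_ofReal_abs]
      rcases le_total 0 r with h | h
      · rw [abs_of_nonneg h, ENNReal.ofReal_of_nonpos (neg_nonpos.2 h), add_zero]
      · rw [abs_of_nonpos h, ENNReal.ofReal_of_nonpos h, zero_add]
    rw [HasFiniteIntegral]
    simp only [this]
    rw [lintegral_add_left' hm.ennreal_ofReal, ← b1, ← b2]
    exact ENNReal.add_lt_top.2 ⟨h1.lt_top, h2.lt_top⟩
  refine ⟨a3, hint, ?_⟩
  rw [hEE, integral_eq_lintegral_pos_part_sub_lintegral_neg_part hint, ← b1, ← b2, EReal.coe_sub,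
    EReal.coe_ennreal_toReal h1, EReal.coe_ennreal_toReal h2]

theorem aux_affine {m : ℕ} (g : (Fin m → ℝ) → EReal) (hlsc : LowerSemicontinuous g)
    (hconv : ∀ (a b : ℝ) (u₁ u₂ : Fin m → ℝ), 0 < a → 0 < b → a + b = 1 →
      g (a • u₁ + b • u₂) ≤ (a : EReal) * g u₁ + (b : EReal) * g u₂)
    (u0 : Fin m → ℝ) (htop : g u0 ≠ ⊤) (c : ℝ) (hc : (c : EReal) < g u0) :
    ∃ (y : Fin m → ℝ) (r : ℝ), (∀ u, (r : EReal) ≤ g u - ((dotM u y : ℝ) : EReal)) ∧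
      c < r + dotM u0 y := by
  set E : Set ((Fin m → ℝ) × ℝ) := {p | g p.1 ≤ ((p.2 : ℝ) : EReal)} with hE
  have hEc : IsClosed E := by
    have h1 := hlsc.isClosed_epigraph
    have h2 : Continuous fun p : (Fin m → ℝ) × ℝ => (p.1, ((p.2 : ℝ) : EReal)) :=
      continuous_fst.prodMk (continuous_coe_real_ereal.comp continuous_snd)
    exact h1.preimage h2
  have hEconv : Convex ℝ E := by
    rw [convex_iff_forall_pos]
    rintro ⟨u1, r1⟩ h1 ⟨u2, r2⟩ h2 a b ha hb hab
    have h1 : g u1 ≤ (r1 : EReal) := h1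
    have h2 : g u2 ≤ (r2 : EReal) := h2
    change g (a • u1 + b • u2) ≤ ((a * r1 + b * r2 : ℝ) : EReal)
    refine (hconv a b u1 u2 ha hb hab).trans ?_
    rw [EReal.coe_add, EReal.coe_mul, EReal.coe_mul]
    exact add_le_add (mul_le_mul_of_nonneg_left h1 (by exact_mod_cast ha.le))
      (mul_le_mul_of_nonneg_left h2 (by exact_mod_cast hb.le))
  have hnot : (u0, c) ∉ E := fun h => absurd hc (not_lt.2 h)
  obtain ⟨F, s, hF1, hF2⟩ := geometric_hahn_banach_point_closed hEconv hEc hnot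
  have hlin : ∀ (u : Fin m → ℝ) (r : ℝ), F (u, r) =
      dotM u (fun j => F (Pi.single j 1, 0)) + r * F (0, 1) := by
    intro u r
    have : (u, r) = (u, (0:ℝ)) + r • ((0 : Fin m → ℝ), (1:ℝ)) := by simp
    rw [this, map_add, map_smul, smul_eq_mul]
    congr 1
    have h3 := LinearMap.pi_apply_eq_sum_univ
      ((F : ((Fin m → ℝ) × ℝ) →ₗ[ℝ] ℝ).comp (LinearMap.inl ℝ (Fin m → ℝ) ℝ)) u
    simp only [LinearMap.comp_apply, LinearMap.inl_apply, smul_eq_mul] at h3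
    have h4 : ∀ j : Fin m, (fun i => if j = i then (1:ℝ) else 0) = Pi.single j 1 := by
      intro j
      ext i
      simp [Pi.single_apply, eq_comm]
    simp only [h4] at h3
    exact h3
  set a : Fin m → ℝ := fun j => F (Pi.single j 1, 0)
  set b : ℝ := F (0, 1)
  have hbot0 : g u0 ≠ ⊥ := fun h => by rw [h] at hc; exact not_lt_bot hc
  obtain ⟨g0, hg0⟩ : ∃ r : ℝ, g u0 = r := ⟨_, (EReal.coe_toReal htop hbot0).symm⟩
  have hm0 := hF2 (u0, g0) (show g u0 ≤ _ from hg0.le)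
  rw [hlin] at hF1 hm0
  rw [hg0, EReal.coe_lt_coe_iff] at hc
  have hb : 0 < b := by
    have : 0 < (g0 - c) * b := by nlinarith
    exact (pos_iff_pos_of_mul_pos this).1 (by linarith)
  have hdot : ∀ u, dotM u (fun j => -(a j) / b) = -(dotM u a) / b := by
    intro u
    unfold dotM
    rw [← Finset.sum_neg_distrib, Finset.sum_div]
    exact Finset.sum_congr rfl fun j _ => by ring
  refine ⟨fun j => -(a j) / b, s / b, fun u => ?_, ?_⟩
  · rw [hdot]
    rcases eq_or_ne (g u) ⊤ with h | h
    · rw [h]; simp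
    have key : ∀ r : ℝ, g u ≤ r → s / b + (-(dotM u a) / b) ≤ r := by
      intro r hr
      have := hF2 (u, r) hr
      rw [hlin] at this
      rw [← add_div, div_le_iff₀ hb]
      linarith
    rcases eq_or_ne (g u) ⊥ with h' | h'
    · exfalso
      have := key (s / b + (-(dotM u a) / b) - 1) (by rw [h']; exact bot_le)
      linarith
    · obtain ⟨gu, hgu⟩ : ∃ r : ℝ, g u = r := ⟨_, (EReal.coe_toReal h h').symm⟩
      have := key gu hgu.le
      rw [hgu, ← EReal.coe_sub, EReal.coe_le_coe_iff]
      linarith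
  · rw [hdot, ← add_div, lt_div_iff₀ hb]
    linarith

theorem aux_dot_int {Ω : Type} [MeasurableSpace Ω] (P : Measure Ω) [IsFiniteMeasure P] {T : ℕ}
    {nt : Fin (T+1) → ℕ} (x v : Ω → Vec nt) (hx : Measurable x) (hv : Integrable v P) (M : ℝ)
    (hM : ∀ ω, ‖x ω‖ ≤ M) : Integrable (fun ω => dotN nt (x ω) (v ω)) P := by
  unfold dotN
  refine integrable_finsetSum _ fun t _ => integrable_finsetSum _ fun i _ => ?_
  have h1 : Integrable (fun ω => v ω t i) P := (hv.eval t).eval i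
  refine h1.bdd_mul (c := M) ?_ ?_
  · exact (measurable_pi_apply i |>.comp (measurable_pi_apply t |>.comp hx)).aestronglyMeasurable
  · exact Eventually.of_forall fun ω =>
      ((norm_le_pi_norm (x ω t) i).trans (norm_le_pi_norm (x ω) t)).trans (hM ω)

theorem aux_meas {Ω : Type} [mΩ : MeasurableSpace Ω] {T : ℕ} {ℱ : Fin (T+1) → MeasurableSpace Ω}
    (hℱ_le : ∀ t, ℱ t ≤ mΩ) {nt : Fin (T+1) → ℕ} {x : Ω → Vec nt} (hx : x ∈ Nspace nt ℱ) :
    Measurable x :=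
  measurable_pi_lambda _ fun t => (hx t).mono (hℱ_le t) le_rfl

theorem aux_perp {Ω : Type} [mΩ : MeasurableSpace Ω] (P : Measure Ω) [IsProbabilityMeasure P]
    {T : ℕ} (ℱ : Fin (T+1) → MeasurableSpace Ω)
    (hℱ_le : ∀ t, ℱ t ≤ mΩ) (hℱ_mono : Monotone ℱ)
    (nt : Fin (T+1) → ℕ) (v : Ω → Vec nt) (hv : v ∈ Nperp nt ℱ P) :
    ∀ (j k : ℕ), k + j = T + 1 → ∀ x ∈ Nspace nt ℱ, (∀ ω (t : Fin (T+1)), t.1 < k → x ω t = 0) →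
      ∀ b : Ω → ℝ, Integrable b P → (∀ᵐ ω ∂P, dotN nt (x ω) (v ω) ≤ b ω) →
      Integrable (fun ω => dotN nt (x ω) (v ω)) P ∧ ∫ ω, dotN nt (x ω) (v ω) ∂P = 0 := by
  intro j
  induction j with
  | zero =>
    intro k hk x hx h0 b hb hle
    have : (fun ω => dotN nt (x ω) (v ω)) = fun _ => 0 := by
      funext ω
      have : ∀ t, x ω t = 0 := fun t => h0 ω t (by have := t.2; omega)
      simp [dotN, this]
    rw [this]
    simp
  | succ j ih =>
    intro k hk x hx h0 b hb hle
    have hkT : k < T + 1 := by omega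
    set κ : Fin (T+1) := ⟨k, hkT⟩ with hκ
    set w : Ω → ℝ := fun ω => dotN nt (x ω) (v ω) with hw
    let A : ℕ → Set Ω := fun ν => {ω | ‖x ω κ‖ ≤ (ν : ℝ)}
    have hA : ∀ ν, MeasurableSet[ℱ κ] (A ν) := fun ν =>
      (hx κ) (measurableSet_le measurable_norm measurable_const :
        MeasurableSet {z : Fin (nt κ) → ℝ | ‖z‖ ≤ (ν : ℝ)})
    have hA' : ∀ ν, MeasurableSet (A ν) := fun ν => hℱ_le κ _ (hA ν)
    have hcov : AECover P atTop A := by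
      refine ⟨Eventually.of_forall fun ω => ?_, hA'⟩
      obtain ⟨N, hN⟩ := exists_nat_ge ‖x ω κ‖
      filter_upwards [eventually_ge_atTop N] with ν hν
      exact hN.trans (by exact_mod_cast hν)
    have main : ∀ ν, IntegrableOn w (A ν) P ∧ ∫ ω in A ν, w ω ∂P = 0 := by
      intro ν
      let hd : Ω → Vec nt := fun ω t => if t = κ then (A ν).indicator (fun ω => x ω t) ω else 0
      let rs : Ω → Vec nt := fun ω t => if t ≤ κ then 0 else (A ν).indicator (fun ω => x ω t) ω
      have hind : ∀ t, κ ≤ t → Measurable[ℱ t] ((A ν).indicator (fun ω => x ω t)) := fun t ht =>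
        Measurable.indicator (hx t) (hℱ_mono ht _ (hA ν))
      have hhd : hd ∈ Nspace nt ℱ := by
        intro t
        by_cases ht : t = κ
        · simp only [hd, if_pos ht]
          exact hind t ht.ge
        · simp only [hd, if_neg ht]
          exact measurable_const
      have hrs : rs ∈ Nspace nt ℱ := by
        intro t
        by_cases ht : t ≤ κ
        · simp only [rs, if_pos ht]
          exact measurable_const
        · simp only [rs, if_neg ht]
          exact hind t (not_le.1 ht).le
      have hbd : ∀ ω, ‖hd ω‖ ≤ (ν : ℝ) := by
        intro ω
        refine (pi_norm_le_iff_of_nonneg (Nat.cast_nonneg ν)).2 fun t => ?_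
        by_cases ht : t = κ
        · subst ht
          simp only [hd, if_true]
          by_cases hω : ω ∈ A ν
          · rw [indicator_of_mem hω]; exact hω
          · rw [indicator_of_notMem hω]; simp
        · simp only [hd, if_neg ht]; simp
      have hsum : ∀ ω, (A ν).indicator w ω = dotN nt (hd ω) (v ω) + dotN nt (rs ω) (v ω) := by
        intro ω
        have e1 : (A ν).indicator w ω = dotN nt ((A ν).indicator x ω) (v ω) := by
          by_cases hω : ω ∈ A ν
          · simp [indicator_of_mem hω, hw]
          · simp [indicator_of_notMem hω, dotN]
        rw [e1]
        unfold dotN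
        rw [← Finset.sum_add_distrib]
        refine Finset.sum_congr rfl fun t _ => ?_
        rw [← Finset.sum_add_distrib]
        refine Finset.sum_congr rfl fun i _ => ?_
        rw [← add_mul]
        congr 1
        have e2 : (A ν).indicator x ω t = (A ν).indicator (fun ω => x ω t) ω := by
          by_cases hω : ω ∈ A ν
          · simp [indicator_of_mem hω]
          · simp [indicator_of_notMem hω]
        rw [e2]
        rcases lt_trichotomy t κ with ht | ht | ht
        · have hz : (A ν).indicator (fun ω => x ω t) ω = 0 := by
            by_cases hω : ω ∈ A ν
            · rw [indicator_of_mem hω]; exact h0 ω t ht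
            · rw [indicator_of_notMem hω]
          simp [hd, rs, ht.le, ht.ne, hz]
        · simp [hd, rs, ht]
        · simp [hd, rs, ht.ne', not_le.2 ht]
      have i1 : Integrable (fun ω => dotN nt (hd ω) (v ω)) P :=
        aux_dot_int P hd v (aux_meas hℱ_le hhd) hv.2.1 ν hbd
      have i1' : ∫ ω, dotN nt (hd ω) (v ω) ∂P = 0 :=
        hv.2.2 hd ⟨hhd, ν, Eventually.of_forall hbd⟩
      obtain ⟨i2, i2'⟩ := ih (k+1) (by omega) rs hrs
        (by
          intro ω t ht
          have : t ≤ κ := Nat.lt_succ_iff.1 ht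
          simp only [rs, if_pos this])
        (fun ω => |b ω| - dotN nt (hd ω) (v ω)) (hb.abs.sub i1)
        (by
          filter_upwards [hle] with ω hω
          have h1 := hsum ω
          have h2 : (A ν).indicator w ω ≤ |b ω| := by
            by_cases hω' : ω ∈ A ν
            · rw [indicator_of_mem hω']; exact hω.trans (le_abs_self _)
            · rw [indicator_of_notMem hω']; exact abs_nonneg _
          linarith)
      have i3 : Integrable ((A ν).indicator w) P := by
        have : (A ν).indicator w = fun ω => dotN nt (hd ω) (v ω) + dotN nt (rs ω) (v ω) :=
          funext hsum
        rw [this]; exact i1.add i2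
      refine ⟨(integrable_indicator_iff (hA' ν)).1 i3, ?_⟩
      rw [← integral_indicator (hA' ν)]
      simp only [hsum]
      rw [integral_add i1 i2, i1', i2', add_zero]
    have hint : Integrable w P := by
      refine hcov.integrable_of_integral_norm_bounded (2 * ∫ ω, |b ω| ∂P) (fun ν => (main ν).1)
        (Eventually.of_forall fun ν => ?_)
      have hb2 : IntegrableOn (fun ω => 2 * |b ω|) (A ν) P := (hb.abs.const_mul 2).integrableOn
      calc ∫ ω in A ν, ‖w ω‖ ∂P ≤ ∫ ω in A ν, (2 * |b ω| - w ω) ∂P := by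
            refine integral_mono_ae (main ν).1.norm (hb2.sub (main ν).1) (ae_restrict_of_ae ?_)
            filter_upwards [hle] with ω hω
            have h1 : w ω ≤ |b ω| := hω.trans (le_abs_self _)
            have h2 := abs_nonneg (b ω)
            simp only [Real.norm_eq_abs]
            rcases abs_cases (w ω) with ⟨h, _⟩ | ⟨h, _⟩ <;> rw [h] <;> linarith
        _ = ∫ ω in A ν, 2 * |b ω| ∂P := by
            rw [integral_sub hb2 (main ν).1, (main ν).2, sub_zero]
        _ ≤ ∫ ω, 2 * |b ω| ∂P := setIntegral_le_integral (hb.abs.const_mul 2)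
            (Eventually.of_forall fun ω => by positivity)
        _ = 2 * ∫ ω, |b ω| ∂P := integral_const_mul _ _
    refine ⟨hint, ?_⟩
    have ht := hcov.integral_tendsto_of_countably_generated hint
    simp only [(main _).2] at ht
    exact tendsto_nhds_unique ht tendsto_const_nhds

theorem dotN_sub' {T : ℕ} {nt : Fin (T+1) → ℕ} (v a b : Vec nt) :
    dotN nt v (a - b) = dotN nt a v - dotN nt b v := by
  unfold dotN
  rw [← Finset.sum_sub_distrib]
  refine Finset.sum_congr rfl fun t _ => ?_
  rw [← Finset.sum_sub_distrib]
  refine Finset.sum_congr rfl fun i _ => ?_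
  simp only [Pi.sub_apply]; ring

theorem dotN_sub'' {T : ℕ} {nt : Fin (T+1) → ℕ} (v a b : Vec nt) :
    dotN nt (a - b) v = dotN nt a v - dotN nt b v := by
  rw [← dotN_sub']
  unfold dotN
  exact Finset.sum_congr rfl fun t _ => Finset.sum_congr rfl fun i _ => mul_comm _ _

theorem dotM_sub' {m : ℕ} (v a b : Fin m → ℝ) :
    dotM v (a - b) = dotM v a - dotM v b := by
  unfold dotM
  rw [← Finset.sum_sub_distrib]
  refine Finset.sum_congr rfl fun t _ => ?_
  simp only [Pi.sub_apply]; ring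

theorem aux_pw1 {Ω : Type} {T : ℕ} {nt : Fin (T+1) → ℕ} {m : ℕ}
    (f : Vec nt → (Fin m → ℝ) → Ω → EReal) (ω : Ω) (hb : ∀ x u, f x u ω ≠ ⊥)
    (x v : Vec nt) (u y : Fin m → ℝ) (F G : ℝ) (hF : f x u ω = F) (hG : fconj f v y ω = G)
    (hFG : G + F = dotN nt x v + dotM u y) :
    (∀ x' : Vec nt, lagr f x y ω + ((dotN nt v (x' - x) : ℝ) : EReal) ≤ lagr f x' y ω) ∧
    (∀ y' : Fin m → ℝ, -(lagr f x y ω) + ((dotM u (y' - y) : ℝ) : EReal) ≤ -(lagr f x y' ω)) := by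
  have h1 : ∀ x', ((dotN nt x' v - G : ℝ) : EReal) ≤ lagr f x' y ω := by
    intro x'
    refine le_iInf fun u' => ?_
    have h2 : ((dotN nt x' v + dotM u' y : ℝ) : EReal) - f x' u' ω ≤ G := by
      rw [← hG]
      exact le_iSup₂ (f := fun x' u' => ((dotN nt x' v + dotM u' y : ℝ) : EReal) - f x' u' ω) x' u'
    have h3 := hb x' u'
    induction hz : f x' u' ω with
    | bot => exact absurd hz h3
    | top => simp
    | coe r =>
      rw [hz, ← EReal.coe_sub, EReal.coe_le_coe_iff] at h2
      rw [← EReal.coe_sub, EReal.coe_le_coe_iff]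
      linarith
  have h2 : ∀ y', lagr f x y' ω ≤ ((F - dotM u y' : ℝ) : EReal) := by
    intro y'
    rw [EReal.coe_sub, ← hF]
    exact iInf_le (fun u' => f x u' ω - ((dotM u' y' : ℝ) : EReal)) u
  have h3 : lagr f x y ω = ((dotN nt x v - G : ℝ) : EReal) := by
    refine le_antisymm ((h2 y).trans ?_) (h1 x)
    rw [EReal.coe_le_coe_iff]; linarith
  refine ⟨fun x' => ?_, fun y' => ?_⟩
  · rw [h3, ← EReal.coe_add]
    refine le_trans ?_ (h1 x')
    rw [EReal.coe_le_coe_iff, dotN_sub']; linarith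
  · rw [h3, ← EReal.coe_neg, ← EReal.coe_add]
    refine le_trans ?_ (EReal.neg_le_neg_iff.2 (h2 y'))
    rw [← EReal.coe_neg, EReal.coe_le_coe_iff, dotM_sub']; linarith

theorem aux_pw2 {Ω : Type} {T : ℕ} {nt : Fin (T+1) → ℕ} {m : ℕ}
    (f : Vec nt → (Fin m → ℝ) → Ω → EReal) (ω : Ω) (hb : ∀ x u, f x u ω ≠ ⊥)
    (hf_lsc : LowerSemicontinuous (fun p : Vec nt × (Fin m → ℝ) => f p.1 p.2 ω))
    (hf_convex : ∀ (a b : ℝ) (x₁ x₂ : Vec nt) (u₁ u₂ : Fin m → ℝ),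
      0 < a → 0 < b → a + b = 1 →
      f (a • x₁ + b • x₂) (a • u₁ + b • u₂) ω ≤
        (a : EReal) * f x₁ u₁ ω + (b : EReal) * f x₂ u₂ ω)
    (x v : Vec nt) (u y : Fin m → ℝ) (F : ℝ) (hF : f x u ω = F)
    (c1 : ∀ x' : Vec nt, lagr f x y ω + ((dotN nt v (x' - x) : ℝ) : EReal) ≤ lagr f x' y ω)
    (c2 : ∀ y' : Fin m → ℝ,
      -(lagr f x y ω) + ((dotM u (y' - y) : ℝ) : EReal) ≤ -(lagr f x y' ω)) (x' : Vec nt) :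
    ((F + dotN nt v (x' - x) : ℝ) : EReal) ≤ f x' u ω := by
  have hle : ∀ x' y', lagr f x' y' ω ≤ f x' u ω - ((dotM u y' : ℝ) : EReal) := fun x' y' =>
    iInf_le (fun u' => f x' u' ω - ((dotM u' y' : ℝ) : EReal)) u
  have haff : ∀ c : ℝ, c < F → ∃ (y' : Fin m → ℝ) (r : ℝ), (r : EReal) ≤ lagr f x y' ω ∧
      c < r + dotM u y' := by
    intro c hc
    obtain ⟨y', r, h1, h2⟩ := aux_affine (fun u => f x u ω)
      (hf_lsc.comp (continuous_const.prodMk continuous_id : Continuous fun u => (x, u)))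
      (by
        intro a b u₁ u₂ ha hb hab
        have := hf_convex a b x x u₁ u₂ ha hb hab
        rwa [← add_smul, hab, one_smul] at this) u
      (by simp only [hF]; exact EReal.coe_ne_top _) c (by simp only [hF]; exact_mod_cast hc)
    exact ⟨y', r, le_iInf h1, h2⟩
  have hcon : ∀ c : ℝ, c < F → ∃ L : ℝ, lagr f x y ω = L ∧ c < L + dotM u y := by
    intro c hc
    obtain ⟨y', r, h1, h2⟩ := haff c hc
    have h3 := (c2 y').trans (EReal.neg_le_neg_iff.2 h1)
    have h4 := hle x y
    rw [hF] at h4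
    induction hz : lagr f x y ω with
    | bot => rw [hz, ← EReal.coe_neg] at h3; simp at h3
    | top =>
      rw [hz, ← EReal.coe_sub, top_le_iff] at h4
      exact absurd h4 (EReal.coe_ne_top _)
    | coe L =>
      rw [hz, ← EReal.coe_neg, ← EReal.coe_neg, ← EReal.coe_add, EReal.coe_le_coe_iff,
        dotM_sub'] at h3
      exact ⟨L, rfl, by linarith⟩
  obtain ⟨L, hL, -⟩ := hcon (F - 1) (by linarith)
  have hFL : F ≤ L + dotM u y := by
    refine le_of_forall_lt fun c hc => ?_
    obtain ⟨L', hL', h⟩ := hcon c hc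
    rw [hL, EReal.coe_eq_coe_iff] at hL'
    rwa [hL']
  have h5 := (c1 x').trans (hle x' y)
  rw [hL, ← EReal.coe_add] at h5
  induction hz : f x' u ω with
  | bot => exact absurd hz (hb _ _)
  | top => simp
  | coe r =>
    rw [hz, ← EReal.coe_sub, EReal.coe_le_coe_iff] at h5
    rw [EReal.coe_le_coe_iff]
    linarith

theorem aux_fconj_meas {Ω : Type} [MeasurableSpace Ω] (P : Measure Ω) [IsProbabilityMeasure P]
    {T : ℕ} {nt : Fin (T+1) → ℕ} {m : ℕ}
    (f : Vec nt → (Fin m → ℝ) → Ω → EReal)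
    (hf_meas : Measurable (fun p : (Vec nt × (Fin m → ℝ)) × Ω => f p.1.1 p.1.2 p.2))
    (v : Ω → Vec nt) (y : Ω → Fin m → ℝ) (hv : Measurable v) (hy : Measurable y) :
    AEMeasurable (fun ω => fconj f (v ω) (y ω) ω) P := by
  have hm : Measurable (fun p : (Vec nt × (Fin m → ℝ)) × Ω =>
      ((dotN nt p.1.1 (v p.2) + dotM p.1.2 (y p.2) : ℝ) : EReal) - f p.1.1 p.1.2 p.2) := by
    have h1 : Measurable (fun p : (Vec nt × (Fin m → ℝ)) × Ω =>
        (dotN nt p.1.1 (v p.2) + dotM p.1.2 (y p.2) : ℝ)) := by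
      unfold dotN dotM
      fun_prop
    have h2 : Measurable (fun p : (Vec nt × (Fin m → ℝ)) × Ω =>
      ((dotN nt p.1.1 (v p.2) + dotM p.1.2 (y p.2) : ℝ) : EReal)) := h1.coe_real_ereal
    simp only [sub_eq_add_neg]
    exact h2.add hf_meas.neg
  have := aux_sup P _ hm
  convert this using 2 with ω
  rw [fconj, iSup_prod]

end Aux

/-- optimality conditions in terms of the Lagrangian integrand `l`. -/
theorem stmt_12
    {Ω : Type} [mΩ : MeasurableSpace Ω] (P : Measure Ω) [IsProbabilityMeasure P]
    {T : ℕ} (ℱ : Fin (T+1) → MeasurableSpace Ω)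
    (hℱ_le : ∀ t, ℱ t ≤ mΩ) (hℱ_mono : Monotone ℱ)
    (nt : Fin (T+1) → ℕ) {m : ℕ}
    -- `f` is a convex normal integrand
    (f : Vec nt → (Fin m → ℝ) → Ω → EReal)
    (hf_meas : Measurable (fun p : (Vec nt × (Fin m → ℝ)) × Ω => f p.1.1 p.1.2 p.2))
    (hf_proper : ∀ ω, (∀ x u, f x u ω ≠ ⊥) ∧ ∃ x u, f x u ω ≠ ⊤)
    (hf_lsc : ∀ ω, LowerSemicontinuous (fun p : Vec nt × (Fin m → ℝ) => f p.1 p.2 ω))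
    (hf_convex : ∀ (ω : Ω) (a b : ℝ) (x₁ x₂ : Vec nt) (u₁ u₂ : Fin m → ℝ),
      0 < a → 0 < b → a + b = 1 →
      f (a • x₁ + b • x₂) (a • u₁ + b • u₂) ω ≤
        (a : EReal) * f x₁ u₁ ω + (b : EReal) * f x₂ u₂ ω)
    -- `𝓤` and `𝓨` are decomposable subspaces of `L⁰` in separating duality
    (𝓤 𝓨 : Set (Ω → Fin m → ℝ))
    (h𝓤meas : ∀ u ∈ 𝓤, Measurable u) (h𝓨meas : ∀ y ∈ 𝓨, Measurable y)
    (h𝓤sub : ∀ u ∈ 𝓤, ∀ u' ∈ 𝓤, ∀ c : ℝ, u + u' ∈ 𝓤 ∧ c • u ∈ 𝓤)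
    (h𝓨sub : ∀ y ∈ 𝓨, ∀ y' ∈ 𝓨, ∀ c : ℝ, y + y' ∈ 𝓨 ∧ c • y ∈ 𝓨)
    (h𝓤dec : Decomposable P 𝓤) (h𝓨dec : Decomposable P 𝓨)
    (hpair : ∀ u ∈ 𝓤, ∀ y ∈ 𝓨, Integrable (fun ω => dotM (u ω) (y ω)) P)
    (hsep𝓤 : ∀ u ∈ 𝓤, (∀ y ∈ 𝓨, pairing P u y = 0) → u =ᵐ[P] (fun _ => 0))
    (hsep𝓨 : ∀ y ∈ 𝓨, (∀ u ∈ 𝓤, pairing P u y = 0) → y =ᵐ[P] (fun _ => 0))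
    (u : Ω → Fin m → ℝ) (hu : u ∈ 𝓤)
    (hclosed : ∀ x ∈ Nspace nt ℱ, ClosedFn P 𝓤 𝓨 (fun u' => intF P f x u'))
    (hproper : (∀ u' ∈ 𝓤, valueFn P f ℱ u' ≠ ⊥) ∧ ∃ u' ∈ 𝓤, valueFn P f ℱ u' ≠ ⊤)
    (hsubne : (subdiffFn P 𝓤 𝓨 (valueFn P f ℱ) u).Nonempty)
    (hrep : ∀ y ∈ subdiffFn P 𝓤 𝓨 (valueFn P f ℱ) u,
      ∃ v ∈ Nperp nt ℱ P, conj P 𝓤 (valueFn P f ℱ) y = intFconj P f v y) :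
    ∀ x ∈ Nspace nt ℱ,
      (intF P f x u = valueFn P f ℱ u ↔
        (intF P f x u < ⊤ ∧
          ∃ y ∈ 𝓨, ∃ v ∈ Nperp nt ℱ P, ∀ᵐ ω ∂P,
            -- `v(ω) ∈ ∂ₓ l(x(ω), y(ω), ω)`
            (∀ x' : Vec nt,
              lagr f (x ω) (y ω) ω + ((dotN nt (v ω) (x' - x ω) : ℝ) : EReal) ≤
                lagr f x' (y ω) ω) ∧
            -- `u(ω) ∈ ∂_y [−l](x(ω), y(ω), ω)`
            (∀ y' : Fin m → ℝ,
              -(lagr f (x ω) (y ω) ω) + ((dotM (u ω) (y' - y ω) : ℝ) : EReal) ≤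
                -(lagr f (x ω) y' ω)))) := by
  intro x hx
  have hxm := aux_meas hℱ_le hx
  have hum := h𝓤meas u hu
  have hfm : ∀ x' ∈ Nspace nt ℱ, AEMeasurable (fun ω => f (x' ω) (u ω) ω) P := fun x' hx' =>
    (hf_meas.comp (((aux_meas hℱ_le hx').prodMk hum).prodMk measurable_id)).aemeasurable
  have hval : ∀ x' ∈ Nspace nt ℱ, valueFn P f ℱ u ≤ intF P f x' u := fun x' hx' =>
    iInf₂_le x' hx'
  have hbotF : ∀ x' ∈ Nspace nt ℱ, intF P f x' u ≠ ⊥ := by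
    intro x' hx' h
    have := hval x' hx'
    rw [h, le_bot_iff] at this
    exact hproper.1 u hu this
  constructor
  · intro hsol
    obtain ⟨y, hy⟩ := hsubne
    obtain ⟨v, hv, hconj⟩ := hrep y hy
    have htop : valueFn P f ℱ u ≠ ⊤ := by
      intro h
      obtain ⟨u', hu', hne⟩ := hproper.2
      have := hy.2 u' hu'
      rw [h, EReal.top_add_coe, top_le_iff] at this
      exact hne this
    have hFtop : intF P f x u ≠ ⊤ := by rwa [hsol]
    refine ⟨hFtop.lt_top, y, hy.1, v, hv, ?_⟩
    obtain ⟨hF1, hF2, hF3⟩ := aux_EE P _ (hfm x hx) hFtop (hbotF x hx)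
    set F : Ω → ℝ := fun ω => (f (x ω) (u ω) ω).toReal with hFdef
    have hphi : valueFn P f ℱ u = ((∫ ω, F ω ∂P : ℝ) : EReal) := by rw [← hsol]; exact hF3
    have hpairsub : ∀ u' ∈ 𝓤, pairing P (u' - u) y = pairing P u' y - pairing P u y := by
      intro u' hu'
      unfold pairing
      rw [← integral_sub (hpair u' hu' y hy.1) (hpair u hu y hy.1)]
      refine integral_congr_ae (Filter.Eventually.of_forall fun ω => ?_)
      simp only [dotM, Pi.sub_apply, sub_mul, Finset.sum_sub_distrib]
    have hconjval : conj P 𝓤 (valueFn P f ℱ) y =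
        ((pairing P u y - ∫ ω, F ω ∂P : ℝ) : EReal) := by
      apply le_antisymm
      · refine iSup₂_le fun u' hu' => ?_
        have h1 := hy.2 u' hu'
        rw [hphi, hpairsub u' hu', ← EReal.coe_add] at h1
        induction hz : valueFn P f ℱ u' with
        | bot => exact absurd hz (hproper.1 u' hu')
        | top => simp
        | coe r =>
          rw [hz, EReal.coe_le_coe_iff] at h1
          rw [← EReal.coe_sub, EReal.coe_le_coe_iff]
          linarith
      · rw [EReal.coe_sub, ← hphi]
        exact le_iSup₂ (f := fun u' (_ : u' ∈ 𝓤) =>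
          ((pairing P u' y : ℝ) : EReal) - valueFn P f ℱ u') u hu
    rw [hconjval] at hconj
    obtain ⟨hG1, hG2, hG3⟩ := aux_EE P (fun ω => fconj f (v ω) (y ω) ω)
      (aux_fconj_meas P f hf_meas v y hv.1 (h𝓨meas y hy.1))
      (by change intFconj P f v y ≠ ⊤; rw [← hconj]; exact EReal.coe_ne_top _)
      (by change intFconj P f v y ≠ ⊥; rw [← hconj]; exact EReal.coe_ne_bot _)
    set G : Ω → ℝ := fun ω => (fconj f (v ω) (y ω) ω).toReal with hGdef
    have hGint : ∫ ω, G ω ∂P = pairing P u y - ∫ ω, F ω ∂P := by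
      have : ((∫ ω, G ω ∂P : ℝ) : EReal) = ((pairing P u y - ∫ ω, F ω ∂P : ℝ) : EReal) :=
        hG3.symm.trans hconj.symm
      exact_mod_cast this
    have hFY : ∀ᵐ ω ∂P, dotN nt (x ω) (v ω) + dotM (u ω) (y ω) ≤ G ω + F ω := by
      filter_upwards [hF1, hG1] with ω h1 h2
      have h3 : ((dotN nt (x ω) (v ω) + dotM (u ω) (y ω) : ℝ) : EReal) - f (x ω) (u ω) ω
          ≤ fconj f (v ω) (y ω) ω :=
        le_iSup₂ (f := fun x' u' => ((dotN nt x' (v ω) + dotM u' (y ω) : ℝ) : EReal) - f x' u' ω)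
          (x ω) (u ω)
      rw [h1, h2, ← EReal.coe_sub, EReal.coe_le_coe_iff] at h3
      simp only [hFdef, hGdef]
      linarith
    have hp := hpair u hu y hy.1
    obtain ⟨hI, hI0⟩ := aux_perp P ℱ hℱ_le hℱ_mono nt v hv (T+1) 0 (by omega) x hx
      (fun ω t ht => absurd ht (by omega)) (fun ω => G ω + F ω - dotM (u ω) (y ω))
      ((hG2.add hF2).sub hp)
      (by filter_upwards [hFY] with ω h; linarith)
    have hzero : ∫ ω, ((G ω + F ω) - (dotN nt (x ω) (v ω) + dotM (u ω) (y ω))) ∂P = 0 := by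
      have e1 : ∫ ω, (G ω + F ω) ∂P = ∫ ω, G ω ∂P + ∫ ω, F ω ∂P := integral_add hG2 hF2
      have e2 : ∫ ω, (dotN nt (x ω) (v ω) + dotM (u ω) (y ω)) ∂P =
        ∫ ω, dotN nt (x ω) (v ω) ∂P + ∫ ω, dotM (u ω) (y ω) ∂P := integral_add hI hp
      have e3 : pairing P u y = ∫ ω, dotM (u ω) (y ω) ∂P := rfl
      have e4 : ∫ ω, ((G ω + F ω) - (dotN nt (x ω) (v ω) + dotM (u ω) (y ω))) ∂P =
          ∫ ω, (G ω + F ω) ∂P - ∫ ω, (dotN nt (x ω) (v ω) + dotM (u ω) (y ω)) ∂P :=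
        integral_sub (hG2.add hF2) (hI.add hp)
      rw [e4, e1, e2, hI0, hGint, e3]
      ring
    have hae := (integral_eq_zero_iff_of_nonneg_ae
      (f := fun ω => (G ω + F ω) - (dotN nt (x ω) (v ω) + dotM (u ω) (y ω))) (by filter_upwards [hFY] with ω h; simp only [Pi.zero_apply]; linarith)
      ((hG2.add hF2).sub (hI.add hp))).1 hzero
    filter_upwards [hF1, hG1, hae] with ω h1 h2 h3
    refine aux_pw1 f ω (hf_proper ω).1 (x ω) (v ω) (u ω) (y ω) (F ω) (G ω) h1 h2 ?_
    simp only [Pi.zero_apply] at h3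
    linarith
  · rintro ⟨hFtop, y, hy, v, hv, hae⟩
    refine le_antisymm (le_iInf₂ fun x' hx' => ?_) (hval x hx)
    rcases eq_or_ne (intF P f x' u) ⊤ with ht | ht
    · rw [ht]; exact le_top
    obtain ⟨hF1, hF2, hF3⟩ := aux_EE P _ (hfm x hx) hFtop.ne (hbotF x hx)
    obtain ⟨hG1, hG2, hG3⟩ := aux_EE P _ (hfm x' hx') ht (hbotF x' hx')
    have hle : ∀ᵐ ω ∂P, dotN nt ((x' - x) ω) (v ω) ≤
        (f (x' ω) (u ω) ω).toReal - (f (x ω) (u ω) ω).toReal := by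
      filter_upwards [hF1, hG1, hae] with ω h1 h2 h3
      have h4 := aux_pw2 f ω (hf_proper ω).1 (hf_lsc ω) (hf_convex ω) (x ω) (v ω) (u ω) (y ω) _ h1
        h3.1 h3.2 (x' ω)
      rw [h2, EReal.coe_le_coe_iff, dotN_sub'] at h4
      rw [Pi.sub_apply, dotN_sub'']
      linarith
    have hx'' : x' - x ∈ Nspace nt ℱ := fun t => (hx' t).sub (hx t)
    obtain ⟨hI, hI0⟩ := aux_perp P ℱ hℱ_le hℱ_mono nt v hv (T+1) 0 (by omega) (x' - x) hx''
      (fun ω t ht => absurd ht (by omega)) _ (hG2.sub hF2) hle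
    have h5 := integral_mono_ae hI (hG2.sub hF2) hle
    have h6 : ∫ ω, ((f (x' ω) (u ω) ω).toReal - (f (x ω) (u ω) ω).toReal) ∂P = _ :=
      integral_sub hG2 hF2
    have h7 : ∫ ω, (f (x ω) (u ω) ω).toReal ∂P ≤ ∫ ω, (f (x' ω) (u ω) ω).toReal ∂P := by
      rw [hI0] at h5
      have h8 := h5.trans_eq h6
      linarith
    unfold intF
    rw [hF3, hG3, EReal.coe_le_coe_iff]
    exact h7
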